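/- Let H be a real Hilbert space, let A, B ⊆ H be nonempty closed convex sets, and let α, β ∈ (0, 1). Suppose that either H is finite-dimensional, or the interior of A is nonempty, or the interior of B is nonempty. Then the unique element of minimum norm in the closure of the range of I − T_{A,B,α,β} is 2αβ v, where v is the projection of 0 onto the closure of the Minkowski difference A − B = {a − b : a ∈ A, b ∈ B}. -/

import Mathlib

open RealInnerProductSpace Pointwise

theorem aux_vi {H : Type*} [NormedAddCommGroup H] [InnerProductSpace ℝ H]
    {A : Set H} (hAv : Convex ℝ A) {x p : H} (hp : p ∈ A)
    (h : ∀ c ∈ A, ‖x - p‖ ≤ ‖x - c‖) : ∀ c ∈ A, ⟪x - p, c - p⟫ ≤ 0 := by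
  apply (norm_eq_iInf_iff_real_inner_le_zero hAv hp).1
  have : Nonempty A := ⟨⟨p, hp⟩⟩
  apply le_antisymm
  · exact le_ciInf fun c => h c c.2
  · exact ciInf_le (f := fun w : A => ‖x - w‖)
      ⟨0, by rintro _ ⟨c, rfl⟩; exact norm_nonneg _⟩ ⟨p, hp⟩

theorem aux_unique {H : Type*} [NormedAddCommGroup H] [InnerProductSpace ℝ H]
    {A : Set H} {x p q : H} (hp : p ∈ A) (hq : q ∈ A)
    (h : ∀ c ∈ A, ⟪x - p, c - p⟫ ≤ 0) (h' : ∀ c ∈ A, ⟪x - q, c - q⟫ ≤ 0) : p = q := by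
  have h1 := h q hq
  have h2 := h' p hp
  have h3 : ⟪p - q, p - q⟫ ≤ 0 := by
    have : ⟪p - q, p - q⟫ = ⟪x - p, q - p⟫ + ⟪x - q, p - q⟫ := by
      simp only [inner_sub_left, inner_sub_right]; ring
    linarith
  rw [real_inner_self_eq_norm_sq] at h3
  have h4 : ‖p - q‖ = 0 := pow_eq_zero_iff (two_ne_zero) |>.1 (le_antisymm h3 (sq_nonneg _))
  exact sub_eq_zero.1 (norm_eq_zero.1 h4)

theorem aux_nonexp {H : Type*} [NormedAddCommGroup H] [InnerProductSpace ℝ H]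
    {A : Set H} {x y p q : H} (hp : p ∈ A) (hq : q ∈ A)
    (h : ∀ c ∈ A, ⟪x - p, c - p⟫ ≤ 0) (h' : ∀ c ∈ A, ⟪y - q, c - q⟫ ≤ 0) :
    ‖p - q‖ ≤ ‖x - y‖ := by
  have h1 := h q hq
  have h2 := h' p hp
  have h3 : ‖p - q‖ * ‖p - q‖ ≤ ⟪x - y, p - q⟫ := by
    rw [← real_inner_self_eq_norm_mul_norm]
    have : ⟪x - y, p - q⟫ - ⟪p - q, p - q⟫
        = - ⟪x - p, q - p⟫ - ⟪y - q, p - q⟫ := by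
      simp only [inner_sub_left, inner_sub_right]; ring
    linarith
  have h4 := h3.trans (real_inner_le_norm _ _)
  rcases (norm_nonneg (p - q)).eq_or_lt with h5 | h5
  · rw [← h5]; exact norm_nonneg _
  · exact le_of_mul_le_mul_right h4 h5

/-- The penalised problem has a solution with small residual `a - b - w`. -/
theorem aux_fix {H : Type*} [NormedAddCommGroup H] [InnerProductSpace ℝ H] [CompleteSpace H]
    {A B : Set H} (PA PB : H → H)
    (hA : ∀ x, PA x ∈ A) (hB : ∀ x, PB x ∈ B)
    (hPA : ∀ x, ∀ c ∈ A, ⟪x - PA x, c - PA x⟫ ≤ 0)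
    (hPB : ∀ x, ∀ c ∈ B, ⟪x - PB x, c - PB x⟫ ≤ 0)
    (g K : ℝ) (w : H) (hK : 0 < K) (hKg : g < K) (hK1 : g < K * (1 - g)) :
    ∃ a ∈ A, ∃ b ∈ B, (∀ c ∈ A, ⟪g • a - K • (a - b - w), c - a⟫ ≤ 0) ∧
      (∀ c ∈ B, ⟪K • (a - b - w) - b, c - b⟫ ≤ 0) := by
  have hKg' : 0 < K - g := by linarith
  have hK1' : 0 < 1 + K := by linarith
  set s := K / (K - g) with hs
  set t := K / (1 + K) with ht
  have hs0 : 0 ≤ s := by positivity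
  have ht0 : 0 ≤ t := by positivity
  have hst : s * t < 1 := by
    rw [hs, ht, div_mul_div_comm, div_lt_one (by positivity)]
    nlinarith
  have lip : ContractingWith ⟨s * t, by positivity⟩
      (fun a => PA (s • (PB (t • (a - w)) + w))) := by
    refine ⟨by exact_mod_cast hst, LipschitzWith.of_dist_le_mul fun x y => ?_⟩
    rw [dist_eq_norm, dist_eq_norm]
    have h1 := aux_nonexp (hA _) (hA _) (hPA (s • (PB (t • (x - w)) + w)))
      (hPA (s • (PB (t • (y - w)) + w)))
    have h2 := aux_nonexp (hB _) (hB _) (hPB (t • (x - w))) (hPB (t • (y - w)))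
    rw [← smul_sub, norm_smul, Real.norm_of_nonneg hs0, add_sub_add_right_eq_sub] at h1
    rw [← smul_sub, norm_smul, Real.norm_of_nonneg ht0, sub_sub_sub_cancel_right] at h2
    refine h1.trans ?_
    have := mul_le_mul_of_nonneg_left h2 hs0
    rw [← mul_assoc] at this
    exact this
  have : Nonempty H := ⟨0⟩
  have hfix := lip.fixedPoint_isFixedPt
  set a := ContractingWith.fixedPoint _ lip with ha
  have hfix : PA (s • (PB (t • (a - w)) + w)) = a := hfix
  set b := PB (t • (a - w)) with hb
  refine ⟨a, hfix ▸ hA _, b, hB _, fun c hc => ?_, fun c hc => ?_⟩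
  · have h := hPA (s • (b + w)) c hc
    rw [hfix] at h
    have e : g • a - K • (a - b - w) = (K - g) • (s • (b + w) - a) := by
      rw [smul_sub (K - g), smul_smul, hs, mul_div_cancel₀ _ hKg'.ne']
      module
    rw [e, real_inner_smul_left]
    exact mul_nonpos_of_nonneg_of_nonpos hKg'.le h
  · have h := hPB (t • (a - w)) c hc
    rw [← hb] at h
    have e : K • (a - b - w) - b = (1 + K) • (t • (a - w) - b) := by
      rw [smul_sub (1 + K), smul_smul, ht, mul_div_cancel₀ _ hK1'.ne']
      module
    rw [e, real_inner_smul_left]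
    exact mul_nonpos_of_nonneg_of_nonpos hK1'.le h

theorem aux_est {H : Type*} [NormedAddCommGroup H] [InnerProductSpace ℝ H]
    (g K : ℝ) (hg : g < 1) (hg' : -1 < g) (a b a' b' e : H) (he : a - b - (a' - b') = e)
    (h1 : ⟪g • a - K • e, a' - a⟫ ≤ 0) (h2 : ⟪K • e - b, b' - b⟫ ≤ 0) :
    (K - (2 / (1 - g) + 2)) * ‖e‖ ^ 2 ≤ ‖b' - g • a'‖ ^ 2 / (2 * (1 - g)) + ‖a'‖ ^ 2 / 2 := by
  obtain ⟨d, rfl⟩ : ∃ d, b = b' - d := ⟨b' - b, by abel⟩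
  obtain rfl : a = a' - d + e := by rw [← he]; abel
  set G := b' - g • a' with hG
  have hm : 0 < 1 - g := by linarith
  have id1 : ⟪g • (a' - d + e) - K • e, a' - (a' - d + e)⟫ + ⟪K • e - (b' - d), b' - (b' - d)⟫
      = K * ‖e‖ ^ 2 - (⟪G - (2 * g) • e, d⟫ + g * ⟪a', e⟫ - (1 - g) * ‖d‖ ^ 2 + g * ‖e‖ ^ 2) := by
    rw [hG]
    simp only [← real_inner_self_eq_norm_sq, inner_sub_left, inner_sub_right, inner_add_left,
      inner_add_right, real_inner_smul_left]
    rw [real_inner_comm e d]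
    ring
  have q1 : ⟪G - (2 * g) • e, d⟫ - (1 - g) * ‖d‖ ^ 2 ≤ ‖G - (2 * g) • e‖ ^ 2 / (4 * (1 - g)) := by
    have := real_inner_le_norm (G - (2 * g) • e) d
    rw [le_div_iff₀ (by linarith)]
    nlinarith [sq_nonneg (‖G - (2 * g) • e‖ - 2 * (1 - g) * ‖d‖)]
  have q2 : ‖G - (2 * g) • e‖ ^ 2 ≤ 2 * ‖G‖ ^ 2 + 8 * ‖e‖ ^ 2 := by
    have h3 := norm_sub_le G ((2 * g) • e)
    have h4 : ‖(2 * g) • e‖ ≤ 2 * ‖e‖ := by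
      rw [norm_smul]
      gcongr
      rw [Real.norm_eq_abs, abs_le]; constructor <;> linarith
    have h5 : ‖G - (2 * g) • e‖ ≤ ‖G‖ + 2 * ‖e‖ := by linarith
    have h6 := pow_le_pow_left₀ (norm_nonneg _) h5 2
    nlinarith [sq_nonneg (‖G‖ - 2 * ‖e‖)]
  have q3 : g * ⟪a', e⟫ ≤ ‖a'‖ ^ 2 / 2 + ‖e‖ ^ 2 / 2 := by
    have h3 := abs_real_inner_le_norm a' e
    have h4 : g * ⟪a', e⟫ ≤ |⟪a', e⟫| := by
      refine (le_abs_self _).trans ?_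
      rw [abs_mul]
      exact mul_le_of_le_one_left (abs_nonneg _) (abs_le.2 ⟨by linarith, hg.le⟩)
    nlinarith [sq_nonneg (‖a'‖ - ‖e‖)]
  have q4 : ‖G - (2 * g) • e‖ ^ 2 / (4 * (1 - g)) ≤
      ‖G‖ ^ 2 / (2 * (1 - g)) + 2 / (1 - g) * ‖e‖ ^ 2 := by
    have : ‖G‖ ^ 2 / (2 * (1 - g)) + 2 / (1 - g) * ‖e‖ ^ 2 =
        (2 * ‖G‖ ^ 2 + 8 * ‖e‖ ^ 2) / (4 * (1 - g)) := by
      field_simp; ring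
    rw [this]
    gcongr
  nlinarith [sq_nonneg ‖e‖]

/-- If `H` is finite-dimensional, or `int A ≠ ∅`, or `int B ≠ ∅`, then the
unique element of minimum norm in the closure of `ran(I − T_{A,B,α,β})` is `2αβ v`, where
`v = P_{cl(A−B)}(0)` is the minimum-norm element of the closure of `A − B`. -/
theorem stmt_11 {H : Type*} [NormedAddCommGroup H] [InnerProductSpace ℝ H] [CompleteSpace H]
    (A B : Set H) (hAne : A.Nonempty) (hAc : IsClosed A) (hAv : Convex ℝ A)
    (hBne : B.Nonempty) (hBc : IsClosed B) (hBv : Convex ℝ B)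
    (α β : ℝ) (hα : α ∈ Set.Ioo (0 : ℝ) 1) (hβ : β ∈ Set.Ioo (0 : ℝ) 1)
    (PA PB : H → H)
    (hPA : ∀ x, PA x ∈ A ∧ ∀ c ∈ A, ‖x - PA x‖ ≤ ‖x - c‖)
    (hPB : ∀ x, PB x ∈ B ∧ ∀ c ∈ B, ‖x - PB x‖ ≤ ‖x - c‖)
    (T : H → H)
    (hT : ∀ x, T x =
      (1 - α) • x + α • ((2 * β) • PB ((2 * β) • PA x - x) - ((2 * β) • PA x - x)))
    (hcase : FiniteDimensional ℝ H ∨ (interior A).Nonempty ∨ (interior B).Nonempty)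
    (v : H) (hv : v ∈ closure (A - B) ∧ ∀ w ∈ closure (A - B), ‖v‖ ≤ ‖w‖) :
    (2 * α * β) • v ∈ closure (Set.range fun x => x - T x) ∧
    (∀ z ∈ closure (Set.range fun x => x - T x), ‖(2 * α * β) • v‖ ≤ ‖z‖) ∧
    (∀ z ∈ closure (Set.range fun x => x - T x),
      (∀ z' ∈ closure (Set.range fun x => x - T x), ‖z‖ ≤ ‖z'‖) →
        z = (2 * α * β) • v) := by
  have hα0 := hα.1
  have hβ0 := hβ.1
  have hβ1 := hβ.2
  have hR : ∀ x, x - T x = (2 * α * β) • (PA x - PB ((2 * β) • PA x - x)) := by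
    intro x
    rw [hT]
    module
  set k := 2 * α * β with hk
  have hk0 : 0 < k := by positivity
  have hVA : ∀ x, ∀ c ∈ A, ⟪x - PA x, c - PA x⟫ ≤ 0 :=
    fun x => aux_vi hAv (hPA x).1 (hPA x).2
  have hVB : ∀ x, ∀ c ∈ B, ⟪x - PB x, c - PB x⟫ ≤ 0 :=
    fun x => aux_vi hBv (hPB x).1 (hPB x).2
  -- every point of the closure of the range is `k` times a point of `closure (A - B)`
  have hsub : ∀ z ∈ closure (Set.range fun x => x - T x), k⁻¹ • z ∈ closure (A - B) := by
    intro z hz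
    refine map_mem_closure (f := fun z : H => k⁻¹ • z) (continuous_const_smul _) hz ?_
    rintro _ ⟨x, rfl⟩
    simp only [hR]
    rw [smul_smul, inv_mul_cancel₀ hk0.ne', one_smul]
    exact Set.sub_mem_sub (hPA x).1 (hPB _).1
  have hmem : k • v ∈ closure (Set.range fun x => x - T x) := by
    refine map_mem_closure (s := Set.range fun x => PA x - PB ((2 * β) • PA x - x))
      (f := fun z : H => k • z) (continuous_const_smul _) ?_ ?_
    swap
    · rintro _ ⟨x, rfl⟩
      exact ⟨x, hR x⟩
    suffices h : A - B ⊆ closure (Set.range fun x => PA x - PB ((2 * β) • PA x - x)) from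
      closure_minimal h isClosed_closure hv.1
    rintro _ ⟨a', ha', b', hb', rfl⟩
    rw [Metric.mem_closure_iff]
    intro ε hε
    obtain ⟨g, hg⟩ : ∃ g, g = 2 * β - 1 := ⟨_, rfl⟩
    have hm : 0 < 1 - g := by linarith
    obtain ⟨M, hM⟩ : ∃ M, M = ‖b' - g • a'‖ ^ 2 / (2 * (1 - g)) + ‖a'‖ ^ 2 / 2 := ⟨_, rfl⟩
    have hM0 : 0 ≤ M := by rw [hM]; positivity
    obtain ⟨K, hK⟩ : ∃ K, K = (2 / (1 - g) + 2) + (M + 1) / ε ^ 2 := ⟨_, rfl⟩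
    have hp1 : 0 < 2 / (1 - g) := by positivity
    have hp2 : 0 < (M + 1) / ε ^ 2 := by positivity
    have hK1 : g < K * (1 - g) := by
      have : 2 / (1 - g) * (1 - g) = 2 := div_mul_cancel₀ _ hm.ne'
      rw [hK]
      nlinarith
    obtain ⟨a, ha, b, hb, h1, h2⟩ := aux_fix PA PB (fun x => (hPA x).1) (fun x => (hPB x).1)
      hVA hVB g K (a' - b') (by linarith) (by linarith) hK1
    have est := aux_est g K (by linarith) (by linarith) a b a' b' _ rfl (h1 a' ha') (h2 b' hb')
    rw [← hM] at est
    obtain ⟨e, he⟩ : ∃ e, e = a - b - (a' - b') := ⟨_, rfl⟩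
    rw [← he] at h1 h2 est
    have hPAx : PA ((2 * β) • a - K • e) = a := by
      refine aux_unique (hPA _).1 ha (hVA _) fun c hc => ?_
      convert h1 c hc using 2
      rw [hg]; module
    have hPBx : PB (K • e) = b := aux_unique (hPB _).1 hb (hVB _) h2
    refine ⟨a - b, ⟨(2 * β) • a - K • e, ?_⟩, ?_⟩
    · simp only [hPAx, sub_sub_cancel, hPBx]
    · rw [dist_comm, dist_eq_norm]
      change ‖a - b - (a' - b')‖ < ε
      rw [← he]
      have h3 : (M + 1) / ε ^ 2 * ‖e‖ ^ 2 ≤ M := by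
        rw [hK] at est
        linarith
      rw [div_mul_eq_mul_div, div_le_iff₀ (by positivity)] at h3
      by_contra hcon
      push Not at hcon
      have h4 := pow_le_pow_left₀ hε.le hcon 2
      have h5 : 0 < ε ^ 2 := by positivity
      nlinarith
  have hmin : ∀ z ∈ closure (Set.range fun x => x - T x), ‖k • v‖ ≤ ‖z‖ := by
    intro z hz
    have h := hv.2 _ (hsub z hz)
    rw [norm_smul, Real.norm_of_nonneg (inv_nonneg.2 hk0.le), inv_mul_eq_div,
      le_div_iff₀ hk0] at h
    rw [norm_smul, Real.norm_of_nonneg hk0.le]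
    linarith
  refine ⟨hmem, hmin, fun z hz hz' => ?_⟩
  have h1 : ‖z‖ = ‖k • v‖ := le_antisymm (hz' _ hmem) (hmin z hz)
  obtain ⟨y, hy⟩ : ∃ y, y = k⁻¹ • z := ⟨_, rfl⟩
  have hzy : z = k • y := by rw [hy, smul_smul, mul_inv_cancel₀ hk0.ne', one_smul]
  have hyc : y ∈ closure (A - B) := hy ▸ hsub z hz
  have hn : ‖y‖ = ‖v‖ := by
    rw [hzy, norm_smul, norm_smul] at h1
    exact mul_left_cancel₀ (norm_ne_zero_iff.2 hk0.ne') h1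
  have hmid := hv.2 _ ((hAv.sub hBv).closure hyc hv.1 (by norm_num : (0 : ℝ) ≤ 1 / 2)
    (by norm_num : (0 : ℝ) ≤ 1 / 2) (by norm_num))
  rw [← smul_add, norm_smul, Real.norm_of_nonneg (by norm_num)] at hmid
  have par := parallelogram_law_with_norm ℝ y v
  have h0 : ‖y - v‖ = 0 := by
    rw [hn] at par
    have := norm_nonneg v
    have := norm_nonneg (y - v)
    nlinarith
  rw [hzy, sub_eq_zero.1 (norm_eq_zero.1 h0)]
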